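/- For any finite hypergraph H and positive integer r ≥ 2, the chromatic number of the r-uniform Kneser hypergraph KG^r(H) satisfies (|V(H)| − r·α(H))/(r−1) ≤ χ(KG^r(H)) ≤ ⌈(|V(H)| − α(H))/(r−1)⌉, where α(H) is the maximum size of a vertex subset containing no hyperedge. -/

import Mathlib

/-- The coboundary of a cochain on the augmented complex of ordered simplices (lists). -/
def coboundary {X R : Type*} [CommRing R] : (List X → R) → List X → R
  | _, [] => 0
  | f, x :: l => f l - coboundary (fun l' => f (x :: l')) l

section Coboundary

variable {X Y R : Type*} [CommRing R]

theorem coboundary_sub (f g : List X → R) :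
    coboundary (fun l => f l - g l) = fun l => coboundary f l - coboundary g l := by
  funext l
  induction l generalizing f g with
  | nil => simp [coboundary]
  | cons x l ih => simp only [coboundary, ih]; ring

theorem coboundary_sum {ι : Type*} (s : Finset ι) (f : ι → List X → R) :
    coboundary (fun l => ∑ i ∈ s, f i l) = fun l => ∑ i ∈ s, coboundary (f i) l := by
  funext l
  induction l generalizing f with
  | nil => simp [coboundary]
  | cons x l ih => simp only [coboundary, ih, Finset.sum_sub_distrib]

theorem coboundary_mul_left (a : R) (f : List X → R) (l : List X) :
    coboundary (fun l => a * f l) l = a * coboundary f l := by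
  induction l generalizing f with
  | nil => simp [coboundary]
  | cons x l ih => simp only [coboundary, ih]; ring

theorem coboundary_coboundary (f : List X → R) (l : List X) :
    coboundary (coboundary f) l = 0 := by
  induction l generalizing f with
  | nil => rfl
  | cons x l ih => simp only [coboundary, coboundary_sub, ih]; ring

theorem coboundary_comp_map (φ : X → Y) (f : List Y → R) (l : List X) :
    coboundary (fun l => f (l.map φ)) l = coboundary f (l.map φ) := by
  induction l generalizing f with
  | nil => rfl
  | cons x l ih =>
    simp only [coboundary, List.map_cons]
    rw [ih (fun l => f (φ x :: l))]

theorem coboundary_congr {f g : List X → R} {l : List X}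
    (h : ∀ l', l'.length + 1 = l.length → f l' = g l') : coboundary f l = coboundary g l := by
  induction l generalizing f g with
  | nil => rfl
  | cons x l ih =>
    simp only [coboundary]
    rw [h l (by simp), ih (fun l' hl' => h (x :: l') (by simp [hl']))]

theorem exists_sublist_of_coboundary_ne_zero {f : List X → R} {l : List X}
    (h : coboundary f l ≠ 0) : ∃ l', l'.Sublist l ∧ l'.length + 1 = l.length ∧ f l' ≠ 0 := by
  induction l generalizing f with
  | nil => exact absurd rfl h
  | cons x l ih =>
    by_cases hl : f l = 0
    · obtain ⟨l', h₁, h₂, h₃⟩ := ih (f := fun l' => f (x :: l')) fun h0 => h (by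
        simp only [coboundary, hl, h0, sub_zero])
      exact ⟨x :: l', h₁.cons_cons x, by simp [h₂], h₃⟩
    · exact ⟨l, List.sublist_cons_self x l, rfl, hl⟩

end Coboundary

section Cocycles

variable {p : ℕ} [Fact p.Prime]

/-- Whether the arc from `s` to `t` in the cyclic order of `ZMod p` wraps around. -/
def wrap (s t : ZMod p) : ℤ := if t.val < s.val then 1 else 0

theorem mul_wrap (s t : ZMod p) : (p : ℤ) * wrap s t = (t - s).val - t.val + s.val := by
  unfold wrap
  split_ifs with h
  · have h1 : (s - t).val = s.val - t.val := ZMod.val_sub h.le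
    have h2 : s - t ≠ 0 := by
      intro h0
      rw [h0, ZMod.val_zero] at h1
      omega
    have : NeZero (s - t) := ⟨h2⟩
    have h3 := ZMod.val_neg_of_ne_zero (s - t)
    have h4 := ZMod.val_lt (s - t)
    rw [neg_sub] at h3
    rw [h3]
    omega
  · have h1 : (t - s).val = t.val - s.val := ZMod.val_sub (not_lt.mp h)
    rw [h1]
    omega

/-- The standard integral 2-cocycle of `ZMod p`. -/
def carry (s t u : ZMod p) : ℤ := wrap t u - wrap s u + wrap s t

theorem carry_add (a s t u : ZMod p) : carry (s + a) (t + a) (u + a) = carry s t u := by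
  have hp : (p : ℤ) ≠ 0 := by exact_mod_cast (Fact.out : p.Prime).ne_zero
  apply mul_left_cancel₀ hp
  simp only [carry, mul_add, mul_sub, mul_wrap, add_sub_add_right_eq_sub]
  ring

theorem sum_wrap_add (s t : ZMod p) :
    ((∑ a : ZMod p, wrap (s + a) (t + a) : ℤ) : ZMod p) = t - s := by
  have hp : (p : ℤ) ≠ 0 := by exact_mod_cast (Fact.out : p.Prime).ne_zero
  have h : (∑ a : ZMod p, wrap (s + a) (t + a)) = ((t - s).val : ℤ) := by
    apply mul_left_cancel₀ hp
    have e (u : ZMod p) : ∑ a : ZMod p, ((u + a).val : ℤ) = ∑ a : ZMod p, (a.val : ℤ) :=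
      Equiv.sum_comp (Equiv.addLeft u) fun a : ZMod p => (a.val : ℤ)
    simp only [Finset.mul_sum, mul_wrap, add_sub_add_right_eq_sub, Finset.sum_add_distrib,
      Finset.sum_sub_distrib, e]
    simp [ZMod.card]
  rw [h]
  simp

/-- The cup power of `carry`, on lists of odd length. -/
def carryPow : List (ZMod p) → ZMod p
  | [] => 0
  | [_] => 1
  | [_, _] => 0
  | s :: t :: u :: l => carry s t u * carryPow (u :: l)

/-- The cup product of the degree one cocycle with `carryPow`. -/
def diffCarryPow : List (ZMod p) → ZMod p
  | [] => 0
  | [_] => 0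
  | s :: t :: l => (t - s) * carryPow (t :: l)

/-- A cochain with coboundary `diffCarryPow`. -/
def idCarryPow : List (ZMod p) → ZMod p
  | [] => 0
  | s :: l => s * carryPow (s :: l)

/-- A cochain with coboundary `carryPow`. -/
def wrapCarryPow : List (ZMod p) → ZMod p
  | [] => 1
  | [_] => 0
  | s :: t :: l => wrap s t * carryPow (t :: l)

theorem coboundary_carryPow (l : List (ZMod p)) : coboundary carryPow l = 0 := by
  induction hn : l.length using Nat.strong_induction_on generalizing l with
  | _ n ih =>
  match l, hn with
  | [], _ => rfl
  | [s], _ => simp [coboundary, carryPow]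
  | [s, t], _ => simp [coboundary, carryPow]
  | [s, t, u], _ => simp [coboundary, carryPow]
  | s :: t :: u :: v :: l, hn =>
    have h1 := ih (l.length + 2) (by simp at hn; omega) (u :: v :: l) rfl
    simp only [coboundary, carryPow, coboundary_mul_left] at h1 ⊢
    simp only [carry] at h1 ⊢
    push_cast
    linear_combination (wrap t u - wrap s u + wrap s t : ZMod p) * h1

theorem coboundary_carryPow_cons (s : ZMod p) (l : List (ZMod p)) :
    coboundary (fun l' => carryPow (s :: l')) l = carryPow l := by
  have h := coboundary_carryPow (s :: l)
  simp only [coboundary] at h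
  linear_combination -h

theorem coboundary_idCarryPow : coboundary (idCarryPow (p := p)) = diffCarryPow := by
  funext l
  match l with
  | [] => rfl
  | [s] => simp [coboundary, idCarryPow, diffCarryPow]
  | s :: t :: l =>
    have h := coboundary_carryPow_cons s (t :: l)
    simp only [coboundary, idCarryPow, diffCarryPow, coboundary_mul_left] at h ⊢
    linear_combination (-s) * h

theorem coboundary_wrapCarryPow : coboundary (wrapCarryPow (p := p)) = carryPow := by
  funext l
  match l with
  | [] => rfl
  | [s] => simp [coboundary, wrapCarryPow, carryPow]
  | [s, t] => simp [coboundary, wrapCarryPow, carryPow]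
  | s :: t :: u :: l =>
    have h := coboundary_carryPow_cons t (u :: l)
    simp only [coboundary, wrapCarryPow, carryPow, coboundary_mul_left] at h ⊢
    simp only [carry]
    push_cast
    linear_combination (wrap s t : ZMod p) * h

theorem carryPow_map_add (a : ZMod p) (l : List (ZMod p)) :
    carryPow (l.map (· + a)) = carryPow l := by
  induction l using carryPow.induct with
  | case1 => rfl
  | case2 s => rfl
  | case3 s t => rfl
  | case4 s t u l ih =>
    simp only [List.map_cons, carryPow, carry_add] at ih ⊢
    rw [ih]

theorem idCarryPow_map_add_one (l : List (ZMod p)) :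
    idCarryPow (l.map (· + 1)) - idCarryPow l = carryPow l := by
  cases l with
  | nil => simp [idCarryPow, carryPow]
  | cons s l =>
    have h := carryPow_map_add 1 (s :: l)
    simp only [List.map_cons, idCarryPow] at h ⊢
    rw [h]
    ring

theorem sum_wrapCarryPow_map_add (l : List (ZMod p)) :
    ∑ a : ZMod p, wrapCarryPow (l.map (· + a)) = diffCarryPow l := by
  match l with
  | [] => simp [wrapCarryPow, diffCarryPow, ZMod.card]
  | [s] => simp [wrapCarryPow, diffCarryPow]
  | s :: t :: l =>
    have h (a : ZMod p) := carryPow_map_add a (t :: l)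
    simp only [List.map_cons, wrapCarryPow, diffCarryPow] at h ⊢
    simp only [h, ← Finset.sum_mul]
    rw [← sum_wrap_add s t]
    push_cast
    rfl

theorem isChain_ne_of_carryPow_ne_zero {l : List (ZMod p)} (h : carryPow l ≠ 0) :
    l.IsChain (· ≠ ·) := by
  induction l using carryPow.induct with
  | case1 => simp
  | case2 s => simp
  | case3 s t => simp [carryPow] at h
  | case4 s t u l ih =>
    simp only [carryPow] at h
    have h1 := left_ne_zero_of_mul h
    refine .cons_cons ?_ (.cons_cons ?_ (ih (right_ne_zero_of_mul h)))
    · rintro rfl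
      simp [carry, wrap] at h1
    · rintro rfl
      simp [carry, wrap] at h1

theorem isChain_ne_of_diffCarryPow_ne_zero {l : List (ZMod p)} (h : diffCarryPow l ≠ 0) :
    l.IsChain (· ≠ ·) := by
  match l with
  | [] => simp
  | [s] => simp
  | s :: t :: l =>
    simp only [diffCarryPow] at h
    refine .cons_cons ?_ (isChain_ne_of_carryPow_ne_zero (right_ne_zero_of_mul h))
    rintro rfl
    simp at h

end Cocycles

section Subdivision

variable {X Y R : Type*} [CommRing R]

/-- Auxiliary recursion for `subdivide`, by the number of vertices. -/
def subdivideAux (φ : List X → Y) : ℕ → (List Y → R) → List X → R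
  | 0, f, _ => f []
  | k + 1, f, σ => coboundary (subdivideAux φ k fun l => f (φ σ :: l)) σ

/-- Evaluation of a cochain `f` on the image under the vertex labelling `φ` of the barycentric
subdivision of a simplex. -/
def subdivide (φ : List X → Y) (f : List Y → R) (σ : List X) : R :=
  subdivideAux φ σ.length f σ

@[simp]
theorem subdivide_nil (φ : List X → Y) (f : List Y → R) : subdivide φ f [] = f [] := rfl

theorem subdivide_of_ne_nil (φ : List X → Y) (f : List Y → R) {σ : List X} (hσ : σ ≠ []) :
    subdivide φ f σ = coboundary (subdivide φ fun l => f (φ σ :: l)) σ := by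
  obtain ⟨x, τ, rfl⟩ := List.exists_cons_of_ne_nil hσ
  change coboundary _ _ = _
  apply coboundary_congr
  intro τ' hτ'
  simp only [List.length_cons, Nat.add_right_cancel_iff] at hτ'
  rw [subdivide, hτ']

theorem subdivide_sub (φ : List X → Y) (f g : List Y → R) (σ : List X) :
    subdivide φ (fun l => f l - g l) σ = subdivide φ f σ - subdivide φ g σ := by
  unfold subdivide
  generalize σ.length = k
  induction k generalizing f g σ with
  | zero => rfl
  | succ k ih => simp only [subdivideAux, funext (ih _ _), coboundary_sub]

theorem subdivide_sum (φ : List X → Y) {ι : Type*} (s : Finset ι) (f : ι → List Y → R)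
    (σ : List X) :
    subdivide φ (fun l => ∑ i ∈ s, f i l) σ = ∑ i ∈ s, subdivide φ (f i) σ := by
  unfold subdivide
  generalize σ.length = k
  induction k generalizing f σ with
  | zero => rfl
  | succ k ih => simp only [subdivideAux, funext (ih _), coboundary_sum]

theorem subdivide_coboundary (φ : List X → Y) (f : List Y → R) :
    subdivide φ (coboundary f) = coboundary (subdivide φ f) := by
  funext σ
  induction hn : σ.length using Nat.strong_induction_on generalizing f σ with
  | _ n ih =>
  rcases eq_or_ne σ [] with rfl | hσ
  · rfl
  rw [subdivide_of_ne_nil _ _ hσ]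
  simp only [coboundary]
  rw [funext (subdivide_sub φ f _), coboundary_sub]
  have h : coboundary (subdivide φ (coboundary fun l => f (φ σ :: l))) σ = 0 := by
    rw [← coboundary_coboundary (subdivide φ fun l => f (φ σ :: l)) σ]
    exact coboundary_congr fun τ hτ => ih τ.length (by omega) _ τ rfl
  simp only [h, sub_zero]

theorem subdivide_map {φ : List X → Y} {g : X → X} {h : Y → Y}
    (hφ : ∀ σ, σ ≠ [] → φ (σ.map g) = h (φ σ)) (f : List Y → R) (σ : List X) :
    subdivide φ f (σ.map g) = subdivide φ (fun l => f (l.map h)) σ := by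
  induction hn : σ.length using Nat.strong_induction_on generalizing f σ with
  | _ n ih =>
  rcases eq_or_ne σ [] with rfl | hσ
  · rfl
  rw [subdivide_of_ne_nil _ _ hσ, subdivide_of_ne_nil _ _ (by simpa using hσ),
    ← coboundary_comp_map]
  apply coboundary_congr
  intro τ hτ
  rw [ih τ.length (by omega) _ τ rfl, hφ σ hσ]
  rfl

/-- A strictly smaller nonempty face. -/
def IsStrictFace (τ σ : List X) : Prop := τ.Sublist σ ∧ τ.length < σ.length

theorem exists_flag_of_subdivide_ne_zero {φ : List X → Y} {f : List Y → R} {σ : List X}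
    (h : subdivide φ f σ ≠ 0) :
    ∃ L : List (List X), L.length = σ.length ∧ L.IsChain (fun σ τ => IsStrictFace τ σ) ∧
      (∀ τ ∈ L, τ ≠ [] ∧ τ.Sublist σ) ∧ f (L.map φ) ≠ 0 := by
  induction hn : σ.length using Nat.strong_induction_on generalizing f σ with
  | _ n ih =>
  rcases eq_or_ne σ [] with rfl | hσ
  · exact ⟨[], by simpa using hn, by simp, by simp, h⟩
  rw [subdivide_of_ne_nil _ _ hσ] at h
  obtain ⟨τ, h₁, h₂, h₃⟩ := exists_sublist_of_coboundary_ne_zero h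
  obtain ⟨L, hL₁, hL₂, hL₃, hL₄⟩ := ih τ.length (by omega) h₃ rfl
  refine ⟨σ :: L, by simp [hL₁]; omega, ?_, ?_, hL₄⟩
  · rw [List.isChain_cons]
    refine ⟨fun τ' hτ' => ?_, hL₂⟩
    have h₄ := (hL₃ τ' (List.mem_of_mem_head? hτ')).2
    have h₅ := h₄.length_le
    exact ⟨h₄.trans h₁, by omega⟩
  · intro τ' hτ'
    rcases List.mem_cons.mp hτ' with rfl | hτ'
    · exact ⟨hσ, List.Sublist.refl _⟩
    · exact ⟨(hL₃ τ' hτ').1, (hL₃ τ' hτ').2.trans h₁⟩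

end Subdivision

section FundamentalChain

variable {p : ℕ} [Fact p.Prime] {V : Type*}

/-- The action of `ZMod p` on signed vertices. -/
def shift (a : ZMod p) (v : V × ZMod p) : V × ZMod p := (v.1, v.2 + a)

theorem map_shift_map_shift (a b : ZMod p) (σ : List (V × ZMod p)) :
    (σ.map (shift a)).map (shift b) = σ.map (shift (a + b)) := by
  rw [List.map_map]
  congr 1
  funext v
  simp [shift, add_assoc]

/-- The operators alternating between the difference and the norm of the `ZMod p`-action
(and the identity in degree `0`). -/
def transfer : ℕ → (List (V × ZMod p) → ZMod p) → List (V × ZMod p) → ZMod p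
  | 0, f, σ => f σ
  | k + 1, f, σ =>
    if Even k then f (σ.map (shift 1)) - f σ else ∑ a : ZMod p, f (σ.map (shift a))

theorem transfer_sub (k : ℕ) (f g : List (V × ZMod p) → ZMod p) :
    transfer k (fun σ => f σ - g σ) = fun σ => transfer k f σ - transfer k g σ := by
  funext σ
  cases k with
  | zero => rfl
  | succ k =>
    simp only [transfer]
    split_ifs
    · ring
    · rw [Finset.sum_sub_distrib]

theorem transfer_coboundary (k : ℕ) (f : List (V × ZMod p) → ZMod p) :
    transfer k (coboundary f) = coboundary (transfer k f) := by
  cases k with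
  | zero => rfl
  | succ k =>
    by_cases hk : Even k
    · have h : transfer (k + 1) f = fun σ => f (σ.map (shift 1)) - f σ := by
        funext σ
        simp [transfer, hk]
      rw [h, coboundary_sub]
      funext σ
      simp [transfer, hk, ← coboundary_comp_map]
    · have h : transfer (k + 1) f = fun σ => ∑ a : ZMod p, f (σ.map (shift a)) := by
        funext σ
        simp [transfer, hk]
      rw [h, coboundary_sum]
      funext σ
      simp [transfer, hk, ← coboundary_comp_map]

theorem transfer_transfer (k : ℕ) (f : List (V × ZMod p) → ZMod p) (σ : List (V × ZMod p)) :
    transfer (k + 1) (transfer (k + 2) f) σ = 0 := by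
  have e (b : ZMod p) : ∑ a : ZMod p, f (σ.map (shift (b + a))) =
      ∑ a : ZMod p, f (σ.map (shift a)) :=
    Equiv.sum_comp (Equiv.addLeft b) fun a => f (σ.map (shift a))
  by_cases hk : Even k
  · have hk' : ¬ Even (k + 1) := by simpa [Nat.even_add_one] using hk
    simp only [transfer, hk, hk', if_true, if_false, map_shift_map_shift, e, sub_self]
  · have hk' : Even (k + 1) := by simpa [Nat.even_add_one] using hk
    simp only [transfer, hk, hk', if_true, if_false, map_shift_map_shift, add_comm _ (1 : ZMod p),
      Finset.sum_sub_distrib, e, sub_self]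

/-- Evaluation on the chain carried by the join of copies of `ZMod p`, one for each vertex. -/
def fundamentalChain : List V → (List (V × ZMod p) → ZMod p) → ZMod p
  | [], f => f []
  | x :: xs, f => fundamentalChain xs (transfer xs.length fun σ => f ((x, 0) :: σ))

theorem fundamentalChain_sub (xs : List V) (f g : List (V × ZMod p) → ZMod p) :
    fundamentalChain xs (fun σ => f σ - g σ) = fundamentalChain xs f - fundamentalChain xs g := by
  induction xs generalizing f g with
  | nil => rfl
  | cons x xs ih => simp only [fundamentalChain, transfer_sub, ih]

theorem fundamentalChain_zero (xs : List V) :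
    fundamentalChain xs (fun _ : List (V × ZMod p) => 0) = 0 := by
  simpa using fundamentalChain_sub xs (fun _ : List (V × ZMod p) => 0) fun _ => 0

theorem fundamentalChain_coboundary (x : V) (xs : List V) (f : List (V × ZMod p) → ZMod p) :
    fundamentalChain (x :: xs) (coboundary f) = fundamentalChain xs (transfer xs.length f) := by
  induction xs generalizing x f with
  | nil => simp [fundamentalChain, transfer, coboundary]
  | cons y xs ih =>
    rw [fundamentalChain]
    simp only [coboundary]
    rw [transfer_sub, fundamentalChain_sub, transfer_coboundary, ih, sub_eq_self]
    cases xs with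
    | nil => simp [fundamentalChain, transfer]
    | cons z xs =>
      simp only [List.length_cons, funext (transfer_transfer _ _), fundamentalChain_zero]

theorem exists_of_fundamentalChain_ne_zero {xs : List V} {f : List (V × ZMod p) → ZMod p}
    (h : fundamentalChain xs f ≠ 0) : ∃ σ : List (V × ZMod p), σ.map Prod.fst = xs ∧ f σ ≠ 0 := by
  induction xs generalizing f with
  | nil => exact ⟨[], rfl, h⟩
  | cons x xs ih =>
    obtain ⟨τ, h₁, h₂⟩ := ih h
    have hs (a : ZMod p) : (τ.map (shift a)).map Prod.fst = xs := by
      rw [List.map_map, ← h₁]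
      rfl
    obtain ⟨τ', h₃, h₄⟩ : ∃ τ' : List (V × ZMod p), τ'.map Prod.fst = xs ∧
        f ((x, 0) :: τ') ≠ 0 := by
      by_contra! hc
      apply h₂
      cases xs.length with
      | zero => exact hc _ h₁
      | succ k =>
        simp only [transfer, hc _ h₁, hc _ (hs _), sub_self, Finset.sum_const_zero, ite_self]
    exact ⟨(x, 0) :: τ', by simp [h₃], h₄⟩

/-- The cocycle generating the cohomology of `ZMod p`, on lists of length `k`. -/
def cyclicCocycle (k : ℕ) : List (ZMod p) → ZMod p :=
  if Even k then diffCarryPow else carryPow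

variable {φ : List (V × ZMod p) → ZMod p}

theorem subdivide_map_shift (hφ : ∀ σ, σ ≠ [] → φ (σ.map (shift 1)) = φ σ + 1) (a : ZMod p)
    (f : List (ZMod p) → ZMod p) (σ : List (V × ZMod p)) :
    subdivide φ f (σ.map (shift a)) = subdivide φ (fun l => f (l.map (· + a))) σ := by
  apply subdivide_map
  intro σ hσ
  rw [← ZMod.natCast_zmod_val a]
  induction a.val with
  | zero =>
    have : (shift 0 : V × ZMod p → V × ZMod p) = id := by funext v; simp [shift]
    simp [this]
  | succ n ih =>
    rw [Nat.cast_succ, ← map_shift_map_shift, hφ _ (by simpa using hσ), ih, add_assoc]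

theorem fundamentalChain_subdivide (hφ : ∀ σ, σ ≠ [] → φ (σ.map (shift 1)) = φ σ + 1)
    (x : V) (xs : List V) :
    fundamentalChain (x :: xs) (subdivide φ (cyclicCocycle (xs.length + 1))) = 1 := by
  induction xs generalizing x with
  | nil =>
    change subdivide φ (cyclicCocycle 1) [(x, 0)] = 1
    rw [subdivide_of_ne_nil _ _ (List.cons_ne_nil _ _)]
    simp [coboundary, cyclicCocycle, carryPow]
  | cons y xs ih =>
    have key : ∃ v : List (ZMod p) → ZMod p, coboundary v = cyclicCocycle (xs.length + 2) ∧
        transfer (xs.length + 1) (subdivide φ v) = subdivide φ (cyclicCocycle (xs.length + 1)) := by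
      by_cases hk : Even xs.length
      · refine ⟨idCarryPow, ?_, ?_⟩
        · rw [coboundary_idCarryPow, cyclicCocycle, if_pos (by simpa [Nat.even_add] using hk)]
        · funext σ
          rw [cyclicCocycle, if_neg (by simpa [Nat.even_add_one] using hk),
            transfer, if_pos hk, subdivide_map_shift hφ, ← subdivide_sub]
          simp only [idCarryPow_map_add_one]
      · refine ⟨wrapCarryPow, ?_, ?_⟩
        · rw [coboundary_wrapCarryPow, cyclicCocycle, if_neg (by simpa [Nat.even_add] using hk)]
        · funext σ
          rw [cyclicCocycle, if_pos (by simpa [Nat.even_add_one] using hk),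
            transfer, if_neg hk]
          simp only [subdivide_map_shift hφ]
          rw [← subdivide_sum]
          simp only [sum_wrapCarryPow_map_add]
    obtain ⟨v, h₁, h₂⟩ := key
    rw [List.length_cons, ← h₁, subdivide_coboundary, fundamentalChain_coboundary,
      List.length_cons, h₂, ih]

/-- An equivariant labelling of the signed simplices with underlying vertices among `xs` has a
complete flag along which consecutive labels differ. -/
theorem exists_flag_isChain_ne (hφ : ∀ σ, σ ≠ [] → φ (σ.map (shift 1)) = φ σ + 1)
    (xs : List V) :
    ∃ L : List (List (V × ZMod p)), L.length = xs.length ∧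
      L.IsChain (fun σ τ => IsStrictFace τ σ ∧ φ σ ≠ φ τ) ∧
      ∀ τ ∈ L, τ ≠ [] ∧ (τ.map Prod.fst).Sublist xs := by
  cases xs with
  | nil => exact ⟨[], rfl, by simp, by simp⟩
  | cons x xs =>
    have h : fundamentalChain (x :: xs) (subdivide φ (cyclicCocycle (xs.length + 1))) ≠ 0 := by
      rw [fundamentalChain_subdivide hφ]
      exact one_ne_zero
    obtain ⟨σ, h₁, h₂⟩ := exists_of_fundamentalChain_ne_zero h
    obtain ⟨L, hL₁, hL₂, hL₃, hL₄⟩ := exists_flag_of_subdivide_ne_zero h₂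
    have hne : (L.map φ).IsChain (· ≠ ·) := by
      unfold cyclicCocycle at hL₄
      split_ifs at hL₄
      · exact isChain_ne_of_diffCarryPow_ne_zero hL₄
      · exact isChain_ne_of_carryPow_ne_zero hL₄
    rw [List.isChain_map] at hne
    refine ⟨L, ?_, ?_, fun τ hτ => ⟨(hL₃ τ hτ).1, ?_⟩⟩
    · rw [hL₁, ← h₁, List.length_map]
    · rw [List.isChain_iff_getElem] at hL₂ hne ⊢
      exact fun i hi => ⟨hL₂ i hi, hne i hi⟩
    · rw [← h₁]
      exact (hL₃ τ hτ).2.map _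

end FundamentalChain

/-- There are `r` pairwise disjoint subsets of `U` of size `m + 1` with the same colour under `c`. -/
def HasDisjointMono {V : Type*} {t : ℕ} (r m : ℕ) (U : Finset V) (c : Finset V → Fin t) : Prop :=
  ∃ f : Fin r → Finset V, (∀ i, f i ⊆ U ∧ (f i).card = m + 1) ∧
    (∀ i j, i ≠ j → Disjoint (f i) (f j)) ∧ ∀ i j, c (f i) = c (f j)

section Kneser

open Classical in
/-- The slices over the least second coordinate occurring in a finite set of pairs. -/
noncomputable def leadSlice {ι : Type*} [Fintype ι] {t : ℕ} (A : Finset (ι × Fin t)) : Finset ι :=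
  Finset.univ.filter fun i => ∃ k, (A.image Prod.snd).min = some k ∧ (i, k) ∈ A

theorem leadSlice_nonempty {ι : Type*} [Fintype ι] {t : ℕ} {A : Finset (ι × Fin t)}
    (hA : A.Nonempty) : (leadSlice A).Nonempty := by
  classical
  obtain ⟨k, hk⟩ := Finset.min_of_nonempty (hA.image Prod.snd)
  obtain ⟨⟨i, k'⟩, hi, rfl⟩ := Finset.mem_image.mp (Finset.mem_of_min hk)
  exact ⟨i, by simpa [leadSlice] using ⟨k', hk, hi⟩⟩

theorem exists_forall_mem_of_leadSlice_eq_univ {ι : Type*} [Fintype ι] [Nonempty ι] {t : ℕ}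
    {A : Finset (ι × Fin t)} (hA : leadSlice A = Finset.univ) : ∃ k, ∀ i, (i, k) ∈ A := by
  classical
  have h (i : ι) : ∃ k, (A.image Prod.snd).min = some k ∧ (i, k) ∈ A := by
    have hi : i ∈ leadSlice A := hA ▸ Finset.mem_univ i
    simpa [leadSlice] using hi
  obtain ⟨k, hk, -⟩ := h (Classical.arbitrary ι)
  refine ⟨k, fun i => ?_⟩
  obtain ⟨k', hk', hi⟩ := h i
  rw [hk] at hk'
  cases hk'
  exact hi

theorem card_le_of_forall_exists_notMem {p t : ℕ} [NeZero p] {A : Finset (ZMod p × Fin t)}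
    (hA : ∀ k, ∃ i, (i, k) ∉ A) : A.card ≤ (p - 1) * t := by
  choose i hi using hA
  have h₁ : (Finset.univ.image fun k => (i k, k)).card = t := by
    rw [Finset.card_image_of_injective _ fun k k' h => (Prod.ext_iff.mp h).2]
    simp
  have h₂ : (Finset.univ.image fun k => (i k, k)) ⊆ Aᶜ := by
    intro a ha
    obtain ⟨k, -, rfl⟩ := Finset.mem_image.mp ha
    simpa using hi k
  have h₃ := Finset.card_le_card h₂
  have h₄ := Finset.card_add_card_compl A
  rw [Fintype.card_prod, ZMod.card, Fintype.card_fin] at h₄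
  rw [Nat.sub_mul, one_mul]
  omega

variable {p : ℕ} [Fact p.Prime] {V : Type*} {t : ℕ}

open Classical in
/-- The pairs of a sign `i` and a colour `k` such that some set of size `m + 1` and colour `k`
lies in the part of `σ` of sign `i`. -/
noncomputable def signedColors (m : ℕ) (c : Finset V → Fin t) (σ : List (V × ZMod p)) :
    Finset (ZMod p × Fin t) :=
  Finset.univ.filter fun a =>
    ∃ F : Finset V, F.card = m + 1 ∧ (∀ x ∈ F, (x, a.1) ∈ σ) ∧ c F = a.2

variable {m : ℕ} {c : Finset V → Fin t}

theorem mem_signedColors {σ : List (V × ZMod p)} {i : ZMod p} {k : Fin t} :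
    (i, k) ∈ signedColors m c σ ↔
      ∃ F : Finset V, F.card = m + 1 ∧ (∀ x ∈ F, (x, i) ∈ σ) ∧ c F = k := by
  simp [signedColors]

theorem signedColors_mono {σ τ : List (V × ZMod p)} (h : τ ⊆ σ) :
    signedColors m c τ ⊆ signedColors m c σ := by
  rintro ⟨i, k⟩ hi
  rw [mem_signedColors] at hi ⊢
  obtain ⟨F, h₁, h₂, h₃⟩ := hi
  exact ⟨F, h₁, fun x hx => h (h₂ x hx), h₃⟩

theorem mem_signedColors_map_shift {σ : List (V × ZMod p)} {i : ZMod p} {k : Fin t} :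
    (i, k) ∈ signedColors m c (σ.map (shift 1)) ↔ (i - 1, k) ∈ signedColors m c σ := by
  have h (x : V) : (x, i) ∈ σ.map (shift 1) ↔ (x, i - 1) ∈ σ := by
    simp only [List.mem_map, shift, Prod.exists, Prod.mk.injEq]
    constructor
    · rintro ⟨y, j, hy, rfl, rfl⟩
      simpa using hy
    · exact fun hx => ⟨x, i - 1, hx, rfl, by ring⟩
  simp only [mem_signedColors, h]

theorem leadSlice_signedColors_map_shift (σ : List (V × ZMod p)) :
    leadSlice (signedColors m c (σ.map (shift 1))) =
      (leadSlice (signedColors m c σ)).map (Equiv.addRight 1).toEmbedding := by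
  classical
  have h : (signedColors m c (σ.map (shift 1))).image Prod.snd =
      (signedColors m c σ).image Prod.snd := by
    ext k
    simp only [Finset.mem_image, Prod.exists, exists_eq_right, mem_signedColors_map_shift]
    exact ⟨fun ⟨i, hi⟩ => ⟨i - 1, hi⟩, fun ⟨i, hi⟩ => ⟨i + 1, by simpa using hi⟩⟩
  ext i
  simp only [leadSlice, Finset.mem_map_equiv, Finset.mem_filter, Finset.mem_univ, true_and, h,
    mem_signedColors_map_shift, Equiv.addRight_symm, Equiv.coe_addRight, sub_eq_add_neg]

open Classical in
/-- The mean of the leading slice of `signedColors`, or the first sign when this is undefined. -/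
noncomputable def signLabel (m : ℕ) (c : Finset V → Fin t) (σ : List (V × ZMod p)) : ZMod p :=
  if ((leadSlice (signedColors m c σ)).card : ZMod p) = 0 then (σ.head?.map Prod.snd).getD 0
  else (∑ i ∈ leadSlice (signedColors m c σ), i) / (leadSlice (signedColors m c σ)).card

theorem signLabel_map_shift {σ : List (V × ZMod p)} (hσ : σ ≠ []) :
    signLabel m c (σ.map (shift 1)) = signLabel m c σ + 1 := by
  obtain ⟨v, τ, rfl⟩ := List.exists_cons_of_ne_nil hσ
  unfold signLabel
  rw [leadSlice_signedColors_map_shift, Finset.card_map]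
  split_ifs with h
  · simp [shift]
  · rw [Finset.sum_map]
    simp only [Equiv.coe_toEmbedding, Equiv.coe_addRight, Finset.sum_add_distrib,
      Finset.sum_const, nsmul_eq_mul, mul_one]
    field_simp

theorem signLabel_eq_of_signedColors_eq {σ τ : List (V × ZMod p)}
    (h : signedColors m c σ = signedColors m c τ) (hne : (signedColors m c σ).Nonempty)
    (hσ : ∀ k, ∃ i, (i, k) ∉ signedColors m c σ) : signLabel m c σ = signLabel m c τ := by
  have h₁ : ((leadSlice (signedColors m c σ)).card : ZMod p) ≠ 0 := by
    rw [Ne, ZMod.natCast_eq_zero_iff]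
    apply Nat.not_dvd_of_pos_of_lt (leadSlice_nonempty hne).card_pos
    conv_rhs => rw [← ZMod.card p]
    rw [Finset.card_lt_iff_ne_univ]
    intro h₂
    obtain ⟨k, hk⟩ := exists_forall_mem_of_leadSlice_eq_univ h₂
    obtain ⟨i, hi⟩ := hσ k
    exact hi (hk i)
  unfold signLabel
  rw [← h, if_neg h₁, if_neg h₁]

theorem length_le_of_signedColors_eq_empty {σ : List (V × ZMod p)} (hσ : (σ.map Prod.fst).Nodup)
    (h : signedColors m c σ = ∅) : σ.length ≤ p * m := by
  classical
  rw [← List.toFinset_card_of_nodup hσ.of_map,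
    Finset.card_eq_sum_card_fiberwise (f := Prod.snd) (t := Finset.univ) fun _ _ => by simp]
  refine (Finset.sum_le_card_nsmul _ _ m fun i _ => ?_).trans (by simp [ZMod.card])
  by_contra! hi
  have hinj : Set.InjOn Prod.fst (σ.toFinset.filter fun a => a.2 = i : Set (V × ZMod p)) := by
    rintro ⟨x, a⟩ ha ⟨y, b⟩ hb hxy
    simp only [Finset.coe_filter, Set.mem_ofPred_eq] at ha hb hxy
    rw [hxy, ha.2, hb.2]
  rw [← Finset.card_image_of_injOn hinj] at hi
  obtain ⟨F, hF, hFc⟩ := Finset.exists_subset_card_eq hi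
  have hmem : (i, c F) ∈ signedColors m c σ := by
    refine mem_signedColors.mpr ⟨F, hFc, fun x hx => ?_, rfl⟩
    simpa using hF hx
  simp [h] at hmem

theorem hasDisjointMono_of_forall_mem_signedColors {U : Finset V} {σ : List (V × ZMod p)}
    (hσ : (σ.map Prod.fst).Nodup) (hU : ∀ v ∈ σ, v.1 ∈ U) {k : Fin t}
    (h : ∀ i, (i, k) ∈ signedColors m c σ) : HasDisjointMono p m U c := by
  simp only [mem_signedColors] at h
  choose F hF₁ hF₂ hF₃ using h
  have e : Fin p ≃ ZMod p := (Fintype.equivFinOfCardEq (ZMod.card p)).symm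
  refine ⟨fun i => F (e i), fun i => ⟨fun x hx => hU _ (hF₂ _ x hx), hF₁ _⟩, fun i j hij => ?_,
    fun i j => by rw [hF₃, hF₃]⟩
  rw [Finset.disjoint_left]
  intro x hx hy
  have := List.inj_on_of_nodup_map hσ (hF₂ _ x hx) (hF₂ _ x hy) rfl
  exact hij (e.injective (Prod.ext_iff.mp this).2)

theorem length_le_of_isChain_lt {X : Type*} {N : ℕ} {ρ : X → ℕ} {L : List X}
    (hL : L.IsChain fun x y => ρ y < ρ x) (hρ : ∀ x ∈ L, 1 ≤ ρ x ∧ ρ x ≤ N) : L.length ≤ N := by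
  have h₁ : (L.map ρ).Pairwise (· > ·) := by
    rw [← List.isChain_iff_pairwise, List.isChain_map]
    exact hL
  have h₂ : (L.map ρ).toFinset ⊆ Finset.Icc 1 N := by
    intro k hk
    simp only [List.mem_toFinset, List.mem_map] at hk
    obtain ⟨x, hx, rfl⟩ := hk
    exact Finset.mem_Icc.mpr (hρ x hx)
  have h₃ := Finset.card_le_card h₂
  rw [List.toFinset_card_of_nodup (h₁.imp fun h => h.ne')] at h₃
  simpa using h₃

theorem hasDisjointMono_prime {U : Finset V} (hU : p * m + (p - 1) * t < U.card)
    (c : Finset V → Fin t) : HasDisjointMono p m U c := by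
  classical
  by_contra hcon
  obtain ⟨L, hL₁, hL₂, hL₃⟩ := exists_flag_isChain_ne (φ := signLabel (p := p) m c)
    (fun _ => signLabel_map_shift) U.toList
  have hnodup : ∀ σ ∈ L, (σ.map Prod.fst).Nodup := fun σ hσ =>
    (hL₃ σ hσ).2.nodup U.nodup_toList
  have hcol : ∀ σ ∈ L, ∀ k, ∃ i, (i, k) ∉ signedColors m c σ := by
    intro σ hσ k
    by_contra! h
    refine hcon (hasDisjointMono_of_forall_mem_signedColors (hnodup σ hσ) (fun v hv => ?_) h)
    exact Finset.mem_toList.mp ((hL₃ σ hσ).2.subset (List.mem_map_of_mem hv))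
  let ρ : List (V × ZMod p) → ℕ := fun σ =>
    if signedColors m c σ = ∅ then σ.length else p * m + (signedColors m c σ).card
  have hle : L.length ≤ p * m + (p - 1) * t := by
    apply length_le_of_isChain_lt (ρ := ρ)
    · rw [List.isChain_iff_getElem] at hL₂ ⊢
      intro i hi
      obtain ⟨⟨hsub, hlt⟩, hne⟩ := hL₂ i hi
      have hm₁ := List.getElem_mem (l := L) (n := i) (by omega)
      have hm₂ := List.getElem_mem hi
      have hmono := signedColors_mono (m := m) (c := c) hsub.subset
      simp only [ρ]
      split_ifs with h₁ h₂ h₂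
      · exact hlt
      · have := length_le_of_signedColors_eq_empty (hnodup _ hm₂) h₁
        have := (Finset.nonempty_iff_ne_empty.mpr h₂).card_pos
        omega
      · rw [h₂] at hmono
        exact absurd (Finset.subset_empty.mp hmono) h₁
      · have := Finset.card_lt_card (hmono.ssubset_of_ne fun h => hne
          (signLabel_eq_of_signedColors_eq h.symm (Finset.nonempty_iff_ne_empty.mpr h₂)
            (hcol _ hm₁)))
        omega
    · intro σ hσ
      simp only [ρ]
      split_ifs with h
      · have := length_le_of_signedColors_eq_empty (hnodup σ hσ) h
        have := List.length_pos_iff.mpr (hL₃ σ hσ).1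
        omega
      · have := card_le_of_forall_exists_notMem (hcol σ hσ)
        have := (Finset.nonempty_iff_ne_empty.mpr h).card_pos
        omega
  rw [hL₁, Finset.length_toList] at hle
  omega

theorem hasDisjointMono_mul {a b m : ℕ} (hb : 0 < b)
    (ihb : ∀ (U : Finset V) (c : Finset V → Fin t), b * m + (b - 1) * t < U.card →
      HasDisjointMono b m U c)
    (iha : ∀ (U : Finset V) (c : Finset V → Fin t),
      a * (b * m + (b - 1) * t) + (a - 1) * t < U.card →
      HasDisjointMono a (b * m + (b - 1) * t) U c)
    {U : Finset V} {c : Finset V → Fin t} (hU : a * b * m + (a * b - 1) * t < U.card) :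
    HasDisjointMono (a * b) m U c := by
  have h (N : Finset V) : ∃ f : Fin b → Finset V, N.card = b * m + (b - 1) * t + 1 →
      (∀ i, f i ⊆ N ∧ (f i).card = m + 1) ∧
      (∀ i j, i ≠ j → Disjoint (f i) (f j)) ∧ ∀ i j, c (f i) = c (f j) := by
    by_cases hN : N.card = b * m + (b - 1) * t + 1
    · obtain ⟨f, hf⟩ := ihb N c (by omega)
      exact ⟨f, fun _ => hf⟩
    · exact ⟨fun _ => ∅, fun h => absurd h hN⟩
  choose f hf using h
  have hU' : a * (b * m + (b - 1) * t) + (a - 1) * t < U.card := by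
    refine lt_of_le_of_lt (le_of_eq ?_) hU
    rcases a with _ | a
    · simp
    · obtain ⟨b, rfl⟩ := Nat.exists_eq_add_of_lt hb
      have : (a + 1) * (0 + b + 1) - 1 = (a + 1) * b + a := by
        rw [Nat.sub_eq_iff_eq_add (Nat.mul_pos (by omega) (by omega))]
        ring
      rw [this]
      simp only [Nat.add_sub_cancel]
      ring
  obtain ⟨g, hg₁, hg₂, hg₃⟩ := iha U (fun N => c (f N ⟨0, hb⟩)) hU'
  have hf' (i : Fin a) := hf (g i) (hg₁ i).2
  refine ⟨fun k => f (g (finProdFinEquiv.symm k).1) (finProdFinEquiv.symm k).2,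
    fun k => ⟨((hf' _).1 _).1.trans (hg₁ _).1, ((hf' _).1 _).2⟩, fun k l hkl => ?_, fun k l => ?_⟩
  · have hne : finProdFinEquiv.symm k ≠ finProdFinEquiv.symm l :=
      finProdFinEquiv.symm.injective.ne hkl
    beta_reduce
    generalize finProdFinEquiv.symm k = x at hne ⊢
    generalize finProdFinEquiv.symm l = y at hne ⊢
    obtain ⟨i, j⟩ := x
    obtain ⟨i', j'⟩ := y
    by_cases hi : i = i'
    · subst hi
      exact (hf' i).2.1 j j' fun hj => hne (by rw [hj])
    · exact (hg₂ i i' hi).mono ((hf' i).1 j).1 ((hf' i').1 j').1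
  · rw [(hf' _).2.2 _ ⟨0, hb⟩, (hf' (finProdFinEquiv.symm l).1).2.2 _ ⟨0, hb⟩]
    exact hg₃ _ _

/-- The Alon–Frankl–Lovász theorem. -/
theorem hasDisjointMono (r m : ℕ) (U : Finset V) (c : Finset V → Fin t)
    (hU : r * m + (r - 1) * t < U.card) : HasDisjointMono r m U c := by
  induction r using induction_on_primes generalizing m U c with
  | zero => exact ⟨fun _ => ∅, fun i => i.elim0, fun i => i.elim0, fun i => i.elim0⟩
  | one =>
    obtain ⟨F, hF, hFc⟩ := Finset.exists_subset_card_eq (n := m + 1) (s := U) (by omega)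
    exact ⟨fun _ => F, fun _ => ⟨hF, hFc⟩, fun i j h => absurd (Subsingleton.elim i j) h,
      fun _ _ => rfl⟩
  | prime_mul q a hq ih =>
    have : Fact q.Prime := ⟨hq⟩
    rw [mul_comm q a] at hU ⊢
    exact hasDisjointMono_mul hq.pos (fun U c h => hasDisjointMono_prime h c)
      (fun U c h => ih _ U c h) hU

end Kneser

section Bounds

variable {V : Type*} [DecidableEq V] {E : Finset (Finset V)} {r : ℕ}

/-- The colouring `c` of the hyperedges has no `r` pairwise disjoint ones of the same colour. -/
def IsKneserColoring {t : ℕ} (E : Finset (Finset V)) (r : ℕ) (c : {e // e ∈ E} → Fin t) : Prop :=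
  ∀ A : Finset {e // e ∈ E}, A.card = r →
    (∀ a ∈ A, ∀ b ∈ A, a ≠ b → Disjoint (a : Finset V) (b : Finset V)) →
    ∃ a ∈ A, ∃ b ∈ A, c a ≠ c b

theorem IsKneserColoring.card_le [Fintype V] {t α : ℕ} {c : {e // e ∈ E} → Fin t}
    (hc : IsKneserColoring E r c) (hE : ∀ e ∈ E, e.Nonempty) (hr : 0 < r)
    (hα : ∀ S : Finset V, (∀ e ∈ E, ¬ e ⊆ S) → S.card ≤ α) :
    Fintype.card V ≤ r * α + (r - 1) * t := by
  by_contra! hcard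
  have hedge (S : Finset V) (hS : α < S.card) : ∃ e : {e // e ∈ E}, (e : Finset V) ⊆ S := by
    by_contra! h
    exact hS.not_ge (hα S fun e he => h ⟨e, he⟩)
  obtain ⟨e₀, -⟩ := hedge Finset.univ (by
    rw [Finset.card_univ]
    have := Nat.le_mul_of_pos_left α hr
    omega)
  have hsel (S : Finset V) : ∃ e : {e // e ∈ E}, α < S.card → (e : Finset V) ⊆ S := by
    by_cases hS : α < S.card
    · obtain ⟨e, he⟩ := hedge S hS
      exact ⟨e, fun _ => he⟩
    · exact ⟨e₀, fun h => absurd h hS⟩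
  choose g hg using hsel
  obtain ⟨f, hf₁, hf₂, hf₃⟩ :=
    hasDisjointMono r α Finset.univ (fun S => c (g S)) (by rwa [Finset.card_univ])
  have hgf (i : Fin r) : (g (f i) : Finset V) ⊆ f i := hg _ (by rw [(hf₁ i).2]; omega)
  have hdisj (i j : Fin r) (hij : i ≠ j) : Disjoint (g (f i) : Finset V) (g (f j) : Finset V) :=
    (hf₂ i j hij).mono (hgf i) (hgf j)
  have hinj : Function.Injective fun i => g (f i) := by
    intro i j hij
    by_contra hne
    have h := hdisj i j hne
    simp only at hij
    rw [hij, disjoint_self, Finset.bot_eq_empty] at h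
    exact (hE _ (g (f j)).2).ne_empty h
  obtain ⟨a, ha, b, hb, hab⟩ := hc (Finset.univ.image fun i => g (f i))
    (by rw [Finset.card_image_of_injective _ hinj, Finset.card_univ, Fintype.card_fin]) (by
      intro a ha b hb hab
      obtain ⟨i, -, rfl⟩ := Finset.mem_image.mp ha
      obtain ⟨j, -, rfl⟩ := Finset.mem_image.mp hb
      exact hdisj i j fun hij => hab (by rw [hij]))
  obtain ⟨i, -, rfl⟩ := Finset.mem_image.mp ha
  obtain ⟨j, -, rfl⟩ := Finset.mem_image.mp hb
  exact hab (hf₃ i j)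

theorem exists_isKneserColoring [Fintype V] (hr : 2 ≤ r) {S : Finset V}
    (hS : ∀ e ∈ E, ¬ e ⊆ S) :
    ∃ c : {e // e ∈ E} → Fin ((Fintype.card V - S.card + r - 2) / (r - 1)),
      IsKneserColoring E r c := by
  have hx (e : {e // e ∈ E}) : ∃ x : {x // x ∈ Sᶜ}, (x : V) ∈ (e : Finset V) := by
    obtain ⟨x, hx, hxS⟩ := Finset.not_subset.mp (hS e e.2)
    exact ⟨⟨x, by simpa using hxS⟩, hx⟩
  choose x hx using hx
  let φ := Sᶜ.equivFin
  have hlt (k : Fin Sᶜ.card) :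
      (k : ℕ) / (r - 1) < (Fintype.card V - S.card + r - 2) / (r - 1) := by
    have hk : (k : ℕ) < Fintype.card V - S.card := k.2.trans_eq (Finset.card_compl S)
    calc (k : ℕ) / (r - 1) < ((k : ℕ) + (r - 1)) / (r - 1) := by
          rw [Nat.add_div_right _ (by omega)]
          omega
      _ ≤ _ := Nat.div_le_div_right (by omega)
  refine ⟨fun e => ⟨φ (x e) / (r - 1), hlt _⟩, fun A hA hdisj => ?_⟩
  by_contra! hmono
  obtain ⟨a₀, ha₀⟩ : A.Nonempty := Finset.card_pos.mp (by omega)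
  have hinj : Set.InjOn (fun e => (φ (x e) : ℕ)) A := by
    intro a ha b hb hab
    by_contra hne
    have h := φ.injective (Fin.ext hab)
    exact Finset.disjoint_left.mp (hdisj a ha b hb hne) (hx a) (h ▸ hx b)
  have hsub : A.image (fun e => (φ (x e) : ℕ)) ⊆
      Finset.Ico (φ (x a₀) / (r - 1) * (r - 1)) (φ (x a₀) / (r - 1) * (r - 1) + (r - 1)) := by
    intro k hk
    obtain ⟨a, ha, rfl⟩ := Finset.mem_image.mp hk
    have h := Fin.ext_iff.mp (hmono a ha a₀ ha₀)
    simp only at h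
    rw [← h, Finset.mem_Ico]
    exact ⟨Nat.div_mul_le_self _ _, Nat.lt_div_mul_add (by omega)⟩
  have h := Finset.card_le_card hsub
  rw [Finset.card_image_of_injOn hinj, hA, Nat.card_Ico] at h
  omega

end Bounds


/-- Lower and upper bounds for the chromatic number of the r-uniform Kneser
hypergraph KG^r(H): (|V| − r·α)/(r−1) ≤ χ ≤ ⌈(|V| − α)/(r−1)⌉.  A proper
coloring of KG^r(H) colors the hyperedges of H so that no r pairwise disjoint
hyperedges are monochromatic; α is the maximum size of a vertex subset of H
containing no hyperedge. -/
theorem kneser_hypergraph_chromatic_bounds {V : Type*} [Fintype V] [DecidableEq V]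
    (E : Finset (Finset V)) (hE : ∀ e ∈ E, e.Nonempty) (r : ℕ) (hr : 2 ≤ r)
    (α χ : ℕ)
    (hα : IsGreatest {k : ℕ | ∃ S : Finset V, (∀ e ∈ E, ¬ e ⊆ S) ∧ S.card = k} α)
    (hχ : IsLeast {t : ℕ | ∃ c : {e // e ∈ E} → Fin t,
        ∀ A : Finset {e // e ∈ E}, A.card = r →
          (∀ a ∈ A, ∀ b ∈ A, a ≠ b → Disjoint (a : Finset V) (b : Finset V)) →
          ∃ a ∈ A, ∃ b ∈ A, c a ≠ c b} χ) :
    (Fintype.card V : ℤ) - r * α ≤ (r - 1) * χ ∧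
    χ ≤ (Fintype.card V - α + r - 2) / (r - 1) := by
  obtain ⟨⟨S, hS, rfl⟩, hmax⟩ := hα
  obtain ⟨⟨c, hc⟩, hmin⟩ := hχ
  refine ⟨?_, hmin (exists_isKneserColoring hr hS)⟩
  have h := IsKneserColoring.card_le hc hE (by omega) fun T hT => hmax ⟨T, hT, rfl⟩
  zify [show 1 ≤ r by omega] at h
  linarith
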